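/- For every integer m ≥ 3, the graph G_{4m} is a 3-γ_t-critical graph; moreover it has maximum degree Δ(G_{4m}) = 4m − 3 and order 4m = Δ(G_{4m}) + 3. -/

import Mathlib

open SimpleGraph

/-- `S` is a total dominating set of `G`: every vertex of `G` has a neighbor in `S`. -/
def IsTDS {V : Type*} (G : SimpleGraph V) (S : Set V) : Prop :=
  ∀ v : V, ∃ u ∈ S, G.Adj v u

/-- The total domination number `γₜ(G)`: the minimum cardinality of a total dominating set. -/
noncomputable def gammaT {V : Type*} (G : SimpleGraph V) : ℕ :=
  sInf {n : ℕ | ∃ S : Set V, IsTDS G S ∧ S.ncard = n}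

/-- The degree of a vertex. -/
noncomputable def deg {V : Type*} (G : SimpleGraph V) (v : V) : ℕ :=
  (G.neighborSet v).ncard

/-- The maximum degree `Δ(G)`. -/
noncomputable def maxDeg {V : Type*} [Fintype V] (G : SimpleGraph V) : ℕ :=
  Finset.univ.sup fun v => deg G v

/-- The vertex-deleted graph `G − v`. -/
def delVert {V : Type*} (G : SimpleGraph V) (v : V) : SimpleGraph {u : V // u ≠ v} :=
  G.induce {u : V | u ≠ v}

/-- `G` is 3-γₜ-critical: `γₜ(G) = 3` and for every vertex `v` that is not adjacent to a
vertex of degree one, `γₜ(G − v) = 2`. -/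
def IsThreeGammaTCritical {V : Type*} (G : SimpleGraph V) : Prop :=
  gammaT G = 3 ∧
    ∀ v : V, (¬ ∃ u : V, G.Adj v u ∧ deg G u = 1) → gammaT (delVert G v) = 2

/-- Vertices of `G_{4m}`: `x, y, z`, `y₁,…,y_{2m−2}` and `z₁,…,z_{2m−1}`;
`Y i` stands for `y_{i+1}` and `Z i` for `z_{i+1}` (0-based `Fin` indices). -/
inductive V40 (m : ℕ) : Type
  | x : V40 m
  | y : V40 m
  | z : V40 m
  | Y : Fin (2 * m - 2) → V40 m
  | Z : Fin (2 * m - 1) → V40 m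
  deriving DecidableEq, Fintype

/-- Base edge relation of `G_{4m}` (the paper's 1-based indices are shifted down by 1):
`x yᵢ`, `x zᵢ`, `y yᵢ`, `y z`, `z zᵢ`, `yᵢ yⱼ` for `i < j`, `j ≠ i + m − 1`,
`zᵢ z_{1+((i+m−2) mod (2m−1))}`, `yᵢ zⱼ` for `j ≠ i`, `j ≠ i + 1`, and the extra edge `y₁ z₂`. -/
def R40 (m : ℕ) : V40 m → V40 m → Prop
  | .x, .Y _ => True
  | .x, .Z _ => True
  | .y, .Y _ => True
  | .y, .z => True
  | .z, .Z _ => True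
  | .Y i, .Y j => i.val < j.val ∧ j.val ≠ i.val + m - 1
  | .Z i, .Z j => j.val = (i.val + m - 1) % (2 * m - 1)
  | .Y i, .Z j => (j.val ≠ i.val ∧ j.val ≠ i.val + 1) ∨ (i.val = 0 ∧ j.val = 1)
  | _, _ => False

/-- The graph `G_{4m}`. -/
def G40 (m : ℕ) : SimpleGraph (V40 m) := SimpleGraph.fromRel (R40 m)

section helpers

lemma tds_two_le {V : Type*} [Finite V] [Nonempty V] (G : SimpleGraph V) (S : Set V)
    (h : IsTDS G S) : 2 ≤ S.ncard := by
  obtain ⟨u, hu, _⟩ := h (Classical.arbitrary V)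
  obtain ⟨w, hw, hadj⟩ := h u
  have : ({u, w} : Set V).ncard = 2 := Set.ncard_pair hadj.ne
  rw [← this]
  apply Set.ncard_le_ncard _ (Set.toFinite _)
  rintro t (rfl | rfl) <;> assumption

lemma gammaT_eq {V : Type*} (G : SimpleGraph V) (n : ℕ) (S : Set V) (h : IsTDS G S)
    (hn : S.ncard = n) (hl : ∀ T, IsTDS G T → n ≤ T.ncard) : gammaT G = n := by
  apply le_antisymm
  · exact Nat.sInf_le ⟨S, h, hn⟩
  · refine le_csInf (Set.nonempty_of_mem (x := n) ⟨S, h, hn⟩) ?_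
    rintro k ⟨T, hT, rfl⟩
    exact hl T hT

lemma del_two {V : Type*} [Finite V] (G : SimpleGraph V) (v a b : V) (ha : a ≠ v) (hb : b ≠ v)
    (h : ∀ w, w ≠ v → G.Adj w a ∨ G.Adj w b) : gammaT (delVert G v) = 2 := by
  haveI : Nonempty {u : V // u ≠ v} := ⟨⟨a, ha⟩⟩
  have hab : a ≠ b := by
    rcases h a ha with h1 | h1
    · exact absurd h1 (G.irrefl)
    · exact h1.ne
  apply gammaT_eq _ 2 {⟨a, ha⟩, ⟨b, hb⟩}
  · rintro ⟨w, hw⟩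
    rcases h w hw with h1 | h1
    · exact ⟨⟨a, ha⟩, by simp, h1⟩
    · exact ⟨⟨b, hb⟩, by simp, h1⟩
  · apply Set.ncard_pair
    simpa using hab
  · intro T hT
    exact tds_two_le _ T hT

lemma three_le {V : Type*} [Finite V] [Nonempty V] (G : SimpleGraph V)
    (h : ∀ a b, G.Adj a b → ∃ w, ¬ G.Adj w a ∧ ¬ G.Adj w b) (T : Set V) (hT : IsTDS G T) :
    3 ≤ T.ncard := by
  by_contra hlt
  have h2 := tds_two_le G T hT
  have h3 : T.ncard = 2 := by omega
  obtain ⟨a, b, hab, rfl⟩ := Set.ncard_eq_two.1 h3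
  have hadj : G.Adj a b := by
    obtain ⟨u, hu, h1⟩ := hT a
    rcases hu with rfl | rfl
    · exact absurd h1 G.irrefl
    · exact h1
  obtain ⟨w, hwa, hwb⟩ := h a b hadj
  obtain ⟨u, hu, h1⟩ := hT w
  rcases hu with rfl | rfl
  · exact hwa h1
  · exact hwb h1

lemma deg_le_three {V : Type*} [Fintype V] (G : SimpleGraph V) (v a b c : V) (hab : a ≠ b)
    (hac : a ≠ c) (hbc : b ≠ c) (ha : ¬ G.Adj v a) (hb : ¬ G.Adj v b) (hc : ¬ G.Adj v c) :
    deg G v ≤ Fintype.card V - 3 := by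
  have h3 : ({a, b, c} : Set V).ncard = 3 := Set.ncard_eq_three.2 ⟨a, b, c, hab, hac, hbc, rfl⟩
  have h4 := Set.ncard_add_ncard_compl ({a, b, c} : Set V)
  rw [Nat.card_eq_fintype_card] at h4
  have : deg G v ≤ ({a, b, c} : Set V)ᶜ.ncard := by
    apply Set.ncard_le_ncard _ (Set.toFinite _)
    rintro t ht (rfl | rfl | rfl)
    · exact ha ht
    · exact hb ht
    · exact hc ht
  omega

variable {m : ℕ}

lemma adj_irr (a : V40 m) : (G40 m).Adj a a ↔ False := by simp

lemma axY (i) : (G40 m).Adj .x (.Y i) ↔ True := by simp [G40, R40]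
lemma aYx (i) : (G40 m).Adj (.Y i) .x ↔ True := by simp [G40, R40]
lemma axZ (i) : (G40 m).Adj .x (.Z i) ↔ True := by simp [G40, R40]
lemma aZx (i) : (G40 m).Adj (.Z i) .x ↔ True := by simp [G40, R40]
lemma ayY (i) : (G40 m).Adj .y (.Y i) ↔ True := by simp [G40, R40]
lemma aYy (i) : (G40 m).Adj (.Y i) .y ↔ True := by simp [G40, R40]
lemma azZ (i) : (G40 m).Adj .z (.Z i) ↔ True := by simp [G40, R40]
lemma aZz (i) : (G40 m).Adj (.Z i) .z ↔ True := by simp [G40, R40]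
lemma ayZ (i) : (G40 m).Adj .y (.Z i) ↔ False := by simp [G40, R40]
lemma aZy (i) : (G40 m).Adj (.Z i) .y ↔ False := by simp [G40, R40]
lemma azY (i) : (G40 m).Adj .z (.Y i) ↔ False := by simp [G40, R40]
lemma aYz (i) : (G40 m).Adj (.Y i) .z ↔ False := by simp [G40, R40]
lemma ayz : (G40 m).Adj .y .z ↔ True := by simp [G40, R40]
lemma azy : (G40 m).Adj .z .y ↔ True := by simp [G40, R40]
lemma axy : (G40 m).Adj .x .y ↔ False := by simp [G40, R40]
lemma ayx : (G40 m).Adj .y .x ↔ False := by simp [G40, R40]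
lemma axz : (G40 m).Adj .x .z ↔ False := by simp [G40, R40]
lemma azx : (G40 m).Adj .z .x ↔ False := by simp [G40, R40]

lemma aYZ (i : Fin (2 * m - 2)) (j : Fin (2 * m - 1)) : (G40 m).Adj (.Y i) (.Z j) ↔
    (j.val ≠ i.val ∧ j.val ≠ i.val + 1) ∨ (i.val = 0 ∧ j.val = 1) := by
  simp [G40, R40]
lemma aZY (i : Fin (2 * m - 2)) (j : Fin (2 * m - 1)) : (G40 m).Adj (.Z j) (.Y i) ↔
    (j.val ≠ i.val ∧ j.val ≠ i.val + 1) ∨ (i.val = 0 ∧ j.val = 1) := by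
  simp [G40, R40]
lemma aYY (i j : Fin (2 * m - 2)) : (G40 m).Adj (.Y i) (.Y j) ↔
    i.val ≠ j.val ∧ j.val + 1 ≠ i.val + m ∧ i.val + 1 ≠ j.val + m := by
  have := i.2
  have := j.2
  simp only [G40, R40, SimpleGraph.fromRel_adj, ne_eq, V40.Y.injEq, Fin.ext_iff]
  omega

lemma modlem (a n : ℕ) (hn : 0 < n) (ha : a < 2 * n) :
    a % n = a ∧ a < n ∨ a % n + n = a ∧ n ≤ a := by
  by_cases h : a < n
  · left; exact ⟨Nat.mod_eq_of_lt h, h⟩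
  · right
    rw [Nat.mod_eq_sub_mod (by omega), Nat.mod_eq_of_lt (by omega)]
    omega

lemma aZZ (hm : 3 ≤ m) (i j : Fin (2 * m - 1)) : (G40 m).Adj (.Z i) (.Z j) ↔
    j.val + 1 = i.val + m ∨ j.val = i.val + m ∨ i.val + 1 = j.val + m ∨ i.val = j.val + m := by
  have hi := i.2
  have hj := j.2
  simp only [G40, R40, SimpleGraph.fromRel_adj, ne_eq, V40.Z.injEq, Fin.ext_iff]
  have h1 := modlem (i.val + m - 1) (2 * m - 1) (by omega) (by omega)
  have h2 := modlem (j.val + m - 1) (2 * m - 1) (by omega) (by omega)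
  omega

lemma card40 (hm : 3 ≤ m) : Fintype.card (V40 m) = 4 * m := by
  let e : V40 m ≃ Fin 3 ⊕ Fin (2 * m - 2) ⊕ Fin (2 * m - 1) :=
    { toFun := fun v => match v with
        | .x => .inl 0
        | .y => .inl 1
        | .z => .inl 2
        | .Y i => .inr (.inl i)
        | .Z i => .inr (.inr i)
      invFun := fun v => match v with
        | .inl 0 => .x
        | .inl 1 => .y
        | .inl 2 => .z
        | .inr (.inl i) => .Y i
        | .inr (.inr i) => .Z i
      left_inv := by rintro (_ | _ | _ | _ | _) <;> rfl
      right_inv := by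
        rintro (i | i | i)
        · fin_cases i <;> rfl
        · rfl
        · rfl }
  rw [Fintype.card_congr e]
  simp
  omega

lemma deg40_le (hm : 3 ≤ m) (v : V40 m) : deg (G40 m) v ≤ 4 * m - 3 := by
  rw [← card40 hm]
  rcases v with _ | _ | _ | i | j
  · apply deg_le_three _ _ .x .y .z <;> simp [axy, axz]
  · apply deg_le_three _ _ .y .x (.Z ⟨0, by omega⟩) <;> simp [ayx, ayZ]
  · apply deg_le_three _ _ .z .x (.Y ⟨0, by omega⟩) <;> simp [azx, azY]
  · apply deg_le_three _ _ (.Y i) .z (.Z ⟨i, by omega⟩) <;> simp [aYz, aYZ]; try omega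
  · by_cases h : j.val < 2 * m - 2
    · apply deg_le_three _ _ (.Z j) .y (.Y ⟨j, h⟩) <;> simp [aZy, aZY] ; try omega
    · apply deg_le_three _ _ (.Z j) .y (.Y ⟨j - 1, by omega⟩) <;> simp [aZy, aZY]; try omega

lemma degx (hm : 3 ≤ m) : deg (G40 m) .x = 4 * m - 3 := by
  have h3 : ({.x, .y, .z} : Set (V40 m)).ncard = 3 :=
    Set.ncard_eq_three.2 ⟨.x, .y, .z, by simp, by simp, by simp, rfl⟩
  have h4 := Set.ncard_add_ncard_compl ({.x, .y, .z} : Set (V40 m))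
  rw [Nat.card_eq_fintype_card, card40 hm] at h4
  have : (G40 m).neighborSet .x = ({.x, .y, .z} : Set (V40 m))ᶜ := by
    ext v
    rcases v with _ | _ | _ | i | j <;> simp [axy, axz, axY, axZ]
  unfold deg
  rw [this]
  omega

lemma maxDeg40 (hm : 3 ≤ m) : maxDeg (G40 m) = 4 * m - 3 := by
  apply le_antisymm
  · exact Finset.sup_le fun v _ => deg40_le hm v
  · rw [← degx hm]
    exact Finset.le_sup (f := fun v => deg (G40 m) v) (Finset.mem_univ _)

lemma undomYZ (hm : 3 ≤ m) (i : Fin (2 * m - 2)) (j : Fin (2 * m - 1)) :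
    ∃ w, ¬ (G40 m).Adj w (.Y i) ∧ ¬ (G40 m).Adj w (.Z j) := by
  have hi := i.2
  have hj := j.2
  by_contra! h
  have h1 := h (.Z ⟨i, by omega⟩)
  have h2 := h (.Z ⟨i + 1, by omega⟩)
  simp only [aZY, aZZ hm] at h1 h2
  by_cases hc : i.val < m - 1
  · have h3 := h (.Y ⟨i + (m - 1), by omega⟩)
    simp only [aYY, aYZ] at h3
    omega
  · have h3 := h (.Y ⟨i - (m - 1), by omega⟩)
    simp only [aYY, aYZ] at h3
    omega

lemma undom (hm : 3 ≤ m) (a b : V40 m) (hab : (G40 m).Adj a b) :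
    ∃ w, ¬ (G40 m).Adj w a ∧ ¬ (G40 m).Adj w b := by
  have hZ : ∀ j, ∃ w, ¬ (G40 m).Adj w .z ∧ ¬ (G40 m).Adj w (.Z j) := by
    intro j
    by_cases h : j.val < 2 * m - 2
    · refine ⟨.Y ⟨j, h⟩, ?_⟩
      rw [aYz, aYZ]; refine ⟨not_false, ?_⟩; simp only []; omega
    · refine ⟨.Y ⟨j - 1, by omega⟩, ?_⟩
      rw [aYz, aYZ]; refine ⟨not_false, ?_⟩; simp only []; omega
  have hY : ∀ i, ∃ w, ¬ (G40 m).Adj w .y ∧ ¬ (G40 m).Adj w (.Y i) := by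
    intro i
    refine ⟨.Z ⟨i, by omega⟩, ?_⟩
    rw [aZy, aZY]; refine ⟨not_false, ?_⟩; simp only []; omega
  rcases a with _ | _ | _ | i | i <;> rcases b with _ | _ | _ | j | j <;>
    (try simp only [adj_irr, axy, axz, ayx, azx, ayZ, azY, aZy, aYz] at hab)
  · exact ⟨.z, by simp [azx, azY]⟩
  · exact ⟨.y, by simp [ayx, ayZ]⟩
  · exact ⟨.x, by simp [axy, axz]⟩
  · exact hY j
  · exact ⟨.x, by simp [axy, axz]⟩
  · exact hZ j
  · exact ⟨.z, by simp [azx, azY]⟩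
  · obtain ⟨w, h1, h2⟩ := hY i; exact ⟨w, h2, h1⟩
  · exact ⟨.z, by simp [azY]⟩
  · exact undomYZ hm i j
  · exact ⟨.y, by simp [ayx, ayZ]⟩
  · obtain ⟨w, h1, h2⟩ := hZ i; exact ⟨w, h2, h1⟩
  · obtain ⟨w, h1, h2⟩ := undomYZ hm j i; exact ⟨w, h2, h1⟩
  · exact ⟨.y, by simp [ayZ]⟩

lemma gamma40 (hm : 3 ≤ m) : gammaT (G40 m) = 3 := by
  haveI : Nonempty (V40 m) := ⟨.x⟩
  apply gammaT_eq _ 3 {.x, .y, .Y ⟨0, by omega⟩}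
  · rintro (_ | _ | _ | i | i)
    · exact ⟨.Y ⟨0, by omega⟩, by simp, by simp [axY]⟩
    · exact ⟨.Y ⟨0, by omega⟩, by simp, by simp [ayY]⟩
    · exact ⟨.y, by simp, by simp [azy]⟩
    · exact ⟨.x, by simp, by simp [aYx]⟩
    · exact ⟨.x, by simp, by simp [aZx]⟩
  · exact Set.ncard_eq_three.2 ⟨.x, .y, .Y ⟨0, by omega⟩, by simp, by simp, by simp, rfl⟩
  · exact three_le _ (undom hm)

/-- Deleting a `Y` or `Z` vertex: a pair `Y p`, `Z q` dominates under arithmetic conditions. -/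
lemma pairYZ (hm : 3 ≤ m) (v : V40 m) (p : Fin (2 * m - 2)) (q : Fin (2 * m - 1))
    (hp : V40.Y p ≠ v) (hq : V40.Z q ≠ v)
    (hY : ∀ k : Fin (2 * m - 2), V40.Y k ≠ v →
      (k.val ≠ p.val ∧ p.val + 1 ≠ k.val + m ∧ k.val + 1 ≠ p.val + m) ∨
      ((q.val ≠ k.val ∧ q.val ≠ k.val + 1) ∨ (k.val = 0 ∧ q.val = 1)))
    (hZ : ∀ k : Fin (2 * m - 1), V40.Z k ≠ v →
      ((k.val ≠ p.val ∧ k.val ≠ p.val + 1) ∨ (p.val = 0 ∧ k.val = 1)) ∨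
      (q.val + 1 = k.val + m ∨ q.val = k.val + m ∨ k.val + 1 = q.val + m ∨ k.val = q.val + m)) :
    gammaT (delVert (G40 m) v) = 2 := by
  apply del_two _ v (.Y p) (.Z q) hp hq
  rintro (_ | _ | _ | k | k) hk
  · simp [axY]
  · simp [ayY]
  · simp [azZ]
  · rw [aYY, aYZ]; exact hY k hk
  · rw [aZY, aZZ hm]; exact hZ k hk

lemma del40 (hm : 3 ≤ m) (v : V40 m) : gammaT (delVert (G40 m) v) = 2 := by
  have h0 : 0 < 2 * m - 2 := by omega
  have h1 : 0 < 2 * m - 1 := by omega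
  rcases v with _ | _ | _ | i | j
  · apply del_two _ _ .y .z (by simp) (by simp)
    rintro (_ | _ | _ | k | k) hk <;> simp_all [ayz, azy, aYy, aZz]
  · apply del_two _ _ .x (.Z ⟨0, h1⟩) (by simp) (by simp)
    rintro (_ | _ | _ | k | k) hk <;> simp_all [axZ, azZ, aYx, aZx]
  · apply del_two _ _ .x (.Y ⟨0, h0⟩) (by simp) (by simp)
    rintro (_ | _ | _ | k | k) hk <;> simp_all [axY, ayY, aYx, aZx]
  · have hi := i.2
    by_cases hc : i.val < m - 1
    · apply pairYZ hm _ ⟨i + (m - 1), by omega⟩ ⟨i, by omega⟩ <;>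
        (try intro k hk; have hk2 := k.2; simp only [ne_eq, V40.Y.injEq, reduceCtorEq, not_false_eq_true, Fin.ext_iff] at hk ⊢) <;>
        (try simp only [ne_eq, V40.Y.injEq, reduceCtorEq, not_false_eq_true, Fin.ext_iff]) <;> omega
    · apply pairYZ hm _ ⟨i - (m - 1), by omega⟩ ⟨i + 1, by omega⟩ <;>
        (try intro k hk; have hk2 := k.2; simp only [ne_eq, V40.Y.injEq, reduceCtorEq, not_false_eq_true, Fin.ext_iff] at hk ⊢) <;>
        (try simp only [ne_eq, V40.Y.injEq, reduceCtorEq, not_false_eq_true, Fin.ext_iff]) <;> omega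
  · have hj := j.2
    rcases Nat.eq_zero_or_pos j.val with hz | hz
    · apply del_two _ _ .y (.Y ⟨0, h0⟩) (by simp) (by simp)
      rintro (_ | _ | _ | k | k) hk
      · simp [axY]
      · simp [ayY]
      · simp [azy]
      · simp [aYy]
      · right
        rw [aZY]
        have hk2 : k.val ≠ 0 := fun e => hk (by rw [V40.Z.injEq, Fin.ext_iff, e, hz])
        by_cases h : k.val = 1
        · exact Or.inr ⟨rfl, h⟩
        · exact Or.inl ⟨hk2, by simpa using h⟩
    · have key : ∃ p q : ℕ, p < 2 * m - 2 ∧ q < 2 * m - 1 ∧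
          (j.val + 2 < m ∧ p = j.val ∧ q = j.val + m + 1 ∨
           m ≤ j.val + 2 ∧ j.val < m ∧ p = j.val ∧ q + m = j.val + 2 ∨
           j.val = m ∧ p + 1 = j.val ∧ q = 2 * m - 2 ∨
           m < j.val ∧ p + 1 = j.val ∧ q + m + 1 = j.val) := by
        by_cases a1 : j.val + 2 < m
        · exact ⟨j.val, j.val + m + 1, by omega, by omega, by omega⟩
        by_cases a2 : j.val < m
        · exact ⟨j.val, j.val + 2 - m, by omega, by omega, by omega⟩
        by_cases a3 : j.val = m
        · exact ⟨j.val - 1, 2 * m - 2, by omega, by omega, by omega⟩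
        · exact ⟨j.val - 1, j.val - m - 1, by omega, by omega, by omega⟩
      obtain ⟨p, q, hp, hq, hpq⟩ := key
      apply pairYZ hm _ ⟨p, hp⟩ ⟨q, hq⟩ <;>
        (try intro k hk; have hk2 := k.2; simp only [ne_eq, V40.Z.injEq, reduceCtorEq, not_false_eq_true, Fin.ext_iff] at hk ⊢) <;>
        (try simp only [ne_eq, V40.Z.injEq, reduceCtorEq, not_false_eq_true, Fin.ext_iff]) <;> omega

end helpers

/-- Theorem 2.8: `G_{4m}` is a 3-γₜ-critical graph with `Δ = 4m − 3` and order
`4m = Δ + 3`, for every `m ≥ 3`. -/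
theorem G40_is_critical (m : ℕ) (hm : 3 ≤ m) :
    IsThreeGammaTCritical (G40 m) ∧ maxDeg (G40 m) = 4 * m - 3 ∧
      Fintype.card (V40 m) = 4 * m ∧ Fintype.card (V40 m) = maxDeg (G40 m) + 3 := by
  exact ⟨⟨gamma40 hm, fun v _ => del40 hm v⟩, maxDeg40 hm, card40 hm, by
    rw [card40 hm, maxDeg40 hm]; omega⟩
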